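/- arXiv:1706.01641 — 4 statements merged into one kernel-verified Lean document; each statement's English description precedes it below -/
import Mathlib

section
/- Core decomposition inequality underlying Theorem 2. In the ontic-model framework, let f_P be any probability density, f_{q1} any probability density, and α ≥ 0. Then the pointwise bound min(f_P, α f_{q1}) ≤ f_P·(γ1_{Λ_{q2}}) + f_P·(γξ_{a1}) + α f_{q1}·(γ(1_{Λ_{q1}}·ξ_{a2}) + γξ_{a3} + γ1_{Λ_{q3}}) holds everywhere on Λ, and consequently ∫ min(f_P, α f_{q1}) dm ≤ P(q2|Q,T,f_P) + P(a1|A,T,f_P) + α·( ∫ (γ(1_{Λ_{q1}}·ξ_{a2})) f_{q1} dm + P(a3|A,T,f_{q1}) + P(q3|Q,T,f_{q1}) ). -/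
open MeasureTheory ProbabilityTheory
open scoped ENNReal

/-- Core decomposition inequality underlying Theorem 2: the pointwise bound
`min(fP, α·fq1) ≤ fP·(γ1_{Λq2}) + fP·(γξ1) + α·fq1·(γ(1_{Λq1}·ξ2) + γξ3 + γ1_{Λq3})`
holds everywhere, and consequently the integrated inequality
`ω(fP, α·fq1) ≤ P(q2|Q,T,fP) + P(a1|A,T,fP)
   + α·(∫ (γ(1_{Λq1}·ξ2)) fq1 dm + P(a3|A,T,fq1) + P(q3|Q,T,fq1))` holds. -/
theorem core_decomposition_inequality {Λ : Type*} [MeasurableSpace Λ]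
    (m : Measure Λ) [SigmaFinite m]
    -- the macro-observable Q: a measurable partition of the ontic state space
    (Λq1 Λq2 Λq3 : Set Λ)
    (hΛq1 : MeasurableSet Λq1) (hΛq2 : MeasurableSet Λq2) (hΛq3 : MeasurableSet Λq3)
    (hd12 : Disjoint Λq1 Λq2) (hd13 : Disjoint Λq1 Λq3) (hd23 : Disjoint Λq2 Λq3)
    (hcover : Λq1 ∪ Λq2 ∪ Λq3 = Set.univ)
    -- the measurement A: response functions with values in [0,1] summing to 1
    (ξ1 ξ2 ξ3 : Λ → ℝ≥0∞)
    (hξ1m : Measurable ξ1) (hξ2m : Measurable ξ2) (hξ3m : Measurable ξ3)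
    (hξ1le : ∀ x, ξ1 x ≤ 1) (hξ2le : ∀ x, ξ2 x ≤ 1) (hξ3le : ∀ x, ξ3 x ≤ 1)
    (hξsum : ∀ x, ξ1 x + ξ2 x + ξ3 x = 1)
    -- the transformation T: a Markov kernel
    (γ : Kernel Λ Λ) [IsMarkovKernel γ]
    -- fP and fq1: arbitrary probability densities
    (fP : Λ → ℝ≥0∞) (hfPm : Measurable fP) (hfPint : ∫⁻ x, fP x ∂m = 1)
    (fq1 : Λ → ℝ≥0∞) (hfq1m : Measurable fq1) (hfq1int : ∫⁻ x, fq1 x ∂m = 1)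
    (α : ℝ≥0∞) :
    (∀ x : Λ,
      min (fP x) (α * fq1 x)
        ≤ fP x * (γ x Λq2) + fP x * (∫⁻ y, ξ1 y ∂(γ x))
          + α * fq1 x * ((∫⁻ y, Λq1.indicator ξ2 y ∂(γ x))
              + (∫⁻ y, ξ3 y ∂(γ x)) + (γ x Λq3)))
    ∧ (∫⁻ x, min (fP x) (α * fq1 x) ∂m)
        ≤ (∫⁻ x, (γ x Λq2) * fP x ∂m) + (∫⁻ x, (∫⁻ y, ξ1 y ∂(γ x)) * fP x ∂m)
          + α * ((∫⁻ x, (∫⁻ y, Λq1.indicator ξ2 y ∂(γ x)) * fq1 x ∂m)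
              + (∫⁻ x, (∫⁻ y, ξ3 y ∂(γ x)) * fq1 x ∂m)
              + (∫⁻ x, (γ x Λq3) * fq1 x ∂m)) := by
  have one_le : ∀ x, 1 ≤ γ x Λq2 + ∫⁻ y, ξ1 y ∂(γ x)
      + ((∫⁻ y, Λq1.indicator ξ2 y ∂(γ x)) + (∫⁻ y, ξ3 y ∂(γ x)) + γ x Λq3) := by
    intro x
    rw [← lintegral_indicator_one hΛq2, ← lintegral_indicator_one hΛq3,
      ← lintegral_add_right _ hξ1m, ← lintegral_add_right _ hξ3m,
      ← lintegral_add_right _ (measurable_one.indicator hΛq3),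
      ← lintegral_add_left ((measurable_one.indicator hΛq2).fun_add hξ1m)]
    calc (1 : ℝ≥0∞) = ∫⁻ _, 1 ∂(γ x) := by simp
      _ ≤ _ := by
        refine lintegral_mono fun y => ?_
        have hy : y ∈ Λq1 ∪ Λq2 ∪ Λq3 := hcover ▸ Set.mem_univ y
        rcases hy with (hy | hy) | hy
        · rw [← hξsum y, Set.indicator_of_mem hy ξ2, add_assoc (ξ1 y)]
          exact add_le_add le_add_self le_self_add
        · rw [Set.indicator_of_mem hy]
          exact le_self_add.trans le_self_add
        · rw [Set.indicator_of_mem hy (1 : Λ → ℝ≥0∞)]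
          exact le_add_self.trans le_add_self
  have pointwise : ∀ x, min (fP x) (α * fq1 x)
      ≤ fP x * (γ x Λq2) + fP x * (∫⁻ y, ξ1 y ∂(γ x))
        + α * fq1 x * ((∫⁻ y, Λq1.indicator ξ2 y ∂(γ x))
            + (∫⁻ y, ξ3 y ∂(γ x)) + (γ x Λq3)) := by
    intro x
    calc min (fP x) (α * fq1 x) = min (fP x) (α * fq1 x) * 1 := (mul_one _).symm
      _ ≤ _ := mul_le_mul_right (one_le x) _
      _ ≤ _ := by
        rw [mul_add, ← mul_add (fP x)]
        gcongr
        · exact min_le_left _ _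
        · exact min_le_right _ _
  refine ⟨pointwise, (lintegral_mono pointwise).trans_eq ?_⟩
  have hq2 : Measurable fun x => γ x Λq2 := γ.measurable_coe hΛq2
  have hq3 : Measurable fun x => γ x Λq3 := γ.measurable_coe hΛq3
  have h1 : Measurable fun x => ∫⁻ y, ξ1 y ∂(γ x) := hξ1m.lintegral_kernel
  have h2 : Measurable fun x => ∫⁻ y, Λq1.indicator ξ2 y ∂(γ x) :=
    (hξ2m.indicator hΛq1).lintegral_kernel
  have h3 : Measurable fun x => ∫⁻ y, ξ3 y ∂(γ x) := hξ3m.lintegral_kernel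
  rw [lintegral_add_left ((hfPm.fun_mul hq2).fun_add (hfPm.fun_mul h1)), lintegral_add_left (hfPm.fun_mul hq2),
    ← lintegral_add_left (h2.fun_mul hfq1m), ← lintegral_add_right _ (hq3.fun_mul hfq1m),
    ← lintegral_const_mul _ (((h2.fun_mul hfq1m).fun_add (h3.fun_mul hfq1m)).fun_add (hq3.fun_mul hfq1m))]
  congr 1
  · simp only [mul_comm]
  · refine lintegral_congr fun x => ?_
    ring
end

section
/- Theorem 1 (eigenpreparation-supported models obey the inequality). In the ontic-model framework, suppose γ_λ is absolutely continuous with respect to m for m-almost every λ, f_{q1} is an eigenpreparation density for q1 (a probability density vanishing m-a.e. outside Λ_{q1}), and the generalized eigenvalue–eigenstate link holds: Λ_{q1} ⊆ {λ : f_{q1}(λ) > 0} up to an m-null set. If moreover P(a2|A,f_{q1}) = 0, P(a3|A,T,f_{q1}) = 0 and P(q3|Q,T,f_{q1}) = 0, then every probability density f_P satisfies P(q1|Q,f_P) ≤ P(q2|Q,T,f_P) + P(a1|A,T,f_P). -/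
open MeasureTheory ProbabilityTheory
open scoped ENNReal

/-- Theorem 1: in an ontic model satisfying the generalized eigenvalue–eigenstate link
for the outcome `q1`, if `P(a2|A,fq1) = P(a3|A,T,fq1) = P(q3|Q,T,fq1) = 0`, then every
preparation density `fP` satisfies `P(q1|Q,fP) ≤ P(q2|Q,T,fP) + P(a1|A,T,fP)`. -/
theorem eigenpreparation_supported_inequality {Λ : Type*} [MeasurableSpace Λ]
    (m : Measure Λ) [SigmaFinite m]
    -- the macro-observable Q: a measurable partition of the ontic state space
    (Λq1 Λq2 Λq3 : Set Λ)
    (hΛq1 : MeasurableSet Λq1) (hΛq2 : MeasurableSet Λq2) (hΛq3 : MeasurableSet Λq3)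
    (hd12 : Disjoint Λq1 Λq2) (hd13 : Disjoint Λq1 Λq3) (hd23 : Disjoint Λq2 Λq3)
    (hcover : Λq1 ∪ Λq2 ∪ Λq3 = Set.univ)
    -- the measurement A: response functions with values in [0,1] summing to 1
    (ξ1 ξ2 ξ3 : Λ → ℝ≥0∞)
    (hξ1m : Measurable ξ1) (hξ2m : Measurable ξ2) (hξ3m : Measurable ξ3)
    (hξ1le : ∀ x, ξ1 x ≤ 1) (hξ2le : ∀ x, ξ2 x ≤ 1) (hξ3le : ∀ x, ξ3 x ≤ 1)
    (hξsum : ∀ x, ξ1 x + ξ2 x + ξ3 x = 1)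
    -- the transformation T: a Markov kernel, a.e. absolutely continuous w.r.t. m
    (γ : Kernel Λ Λ) [IsMarkovKernel γ]
    (hac : ∀ᵐ x ∂m, γ x ≪ m)
    -- fq1: an eigenpreparation density for q1
    (fq1 : Λ → ℝ≥0∞) (hfq1m : Measurable fq1) (hfq1int : ∫⁻ x, fq1 x ∂m = 1)
    (hfq1supp : ∀ᵐ x ∂m, x ∉ Λq1 → fq1 x = 0)
    -- generalized eigenvalue–eigenstate link: Λq1 ⊆ supp fq1 up to an m-null set
    (hlink : m (Λq1 \ {x | 0 < fq1 x}) = 0)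
    -- the three vanishing operational probabilities
    (ha2 : ∫⁻ x, ξ2 x * fq1 x ∂m = 0)
    (ha3T : ∫⁻ x, (∫⁻ y, ξ3 y ∂(γ x)) * fq1 x ∂m = 0)
    (hq3T : ∫⁻ x, (γ x Λq3) * fq1 x ∂m = 0) :
    ∀ fP : Λ → ℝ≥0∞, Measurable fP → (∫⁻ x, fP x ∂m = 1) →
      ∫⁻ x in Λq1, fP x ∂m
        ≤ (∫⁻ x, (γ x Λq2) * fP x ∂m) + (∫⁻ x, (∫⁻ y, ξ1 y ∂(γ x)) * fP x ∂m) := by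
  intro fP hfPm _
  have h2 : ∀ᵐ x ∂m, ξ2 x * fq1 x = 0 :=
    (lintegral_eq_zero_iff (hξ2m.mul hfq1m)).1 ha2
  have h3 : ∀ᵐ x ∂m, (∫⁻ y, ξ3 y ∂(γ x)) * fq1 x = 0 :=
    (lintegral_eq_zero_iff (hξ3m.lintegral_kernel.mul hfq1m)).1 ha3T
  have hq3 : ∀ᵐ x ∂m, γ x Λq3 * fq1 x = 0 :=
    (lintegral_eq_zero_iff ((γ.measurable_coe hΛq3).mul hfq1m)).1 hq3T
  have hpos : ∀ᵐ x ∂m, x ∈ Λq1 → fq1 x ≠ 0 := by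
    filter_upwards [measure_eq_zero_iff_ae_notMem.1 hlink] with x hx hx1 h0
    exact hx ⟨hx1, by simp [h0]⟩
  have hξ2zero : ∀ᵐ y ∂m, y ∈ Λq1 → ξ2 y = 0 := by
    filter_upwards [h2, hpos] with y hy hy0 hy1
    exact (mul_eq_zero.1 hy).resolve_right (hy0 hy1)
  have hone : ∀ᵐ x ∂m, x ∈ Λq1 → 1 ≤ γ x Λq2 + ∫⁻ y, ξ1 y ∂(γ x) := by
    filter_upwards [h3, hq3, hpos, hac] with x hx3 hxq3 hx0 hxac hx1
    have hξ3zero : ∀ᵐ y ∂(γ x), ξ3 y = 0 :=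
      (lintegral_eq_zero_iff hξ3m).1 ((mul_eq_zero.1 hx3).resolve_right (hx0 hx1))
    have hnot3 : ∀ᵐ y ∂(γ x), y ∉ Λq3 :=
      measure_eq_zero_iff_ae_notMem.1 ((mul_eq_zero.1 hxq3).resolve_right (hx0 hx1))
    calc (1 : ℝ≥0∞) = ∫⁻ _, 1 ∂(γ x) := by simp
      _ ≤ ∫⁻ y, Λq2.indicator 1 y + ξ1 y ∂(γ x) := by
        apply lintegral_mono_ae
        filter_upwards [hξ3zero, hnot3, hxac.ae_le hξ2zero] with y hy3 hyn3 hy2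
        by_cases hyq2 : y ∈ Λq2
        · simp [hyq2]
        · have hyq1 : y ∈ Λq1 := by
            have hy : y ∈ Λq1 ∪ Λq2 ∪ Λq3 := hcover ▸ Set.mem_univ y
            simpa [hyq2, hyn3] using hy
          have hsum := hξsum y
          rw [hy2 hyq1, hy3, add_zero, add_zero] at hsum
          simp [hsum]
      _ = γ x Λq2 + ∫⁻ y, ξ1 y ∂(γ x) := by
        rw [lintegral_add_right _ hξ1m, lintegral_indicator_one hΛq2]
  have hmeas : Measurable fun x => γ x Λq2 * fP x := (γ.measurable_coe hΛq2).mul hfPm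
  rw [← lintegral_add_left hmeas, ← lintegral_indicator hΛq1]
  apply lintegral_mono_ae
  filter_upwards [hone] with x hx
  rw [← add_mul]
  by_cases hx1 : x ∈ Λq1
  · simpa [hx1] using mul_le_mul_left (hx hx1) (fP x)
  · simp [hx1]
end

section
/- Criterion for eigenpreparation mixing: let f_{q_1}, …, f_{q_n} be probability densities with respect to m whose supports are pairwise m-a.e. disjoint (m({f_{q_i}>0} ∩ {f_{q_j}>0}) = 0 for i ≠ j), let p_1, …, p_n ≥ 0 with Σ_i p_i = 1, and let f_P be a probability density. Then f_P = Σ_i p_i f_{q_i} m-almost everywhere if and only if ∫ min(f_P, p_i f_{q_i}) dm = p_i for every i. -/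
open MeasureTheory
open scoped ENNReal

/-- Criterion for eigenpreparation mixing: if `f 1, …, f n` are probability densities with
pairwise m-a.e. disjoint supports and `p i ≥ 0` sum to `1`, then a probability density `fP`
equals `∑ i, p i • f i` m-a.e. iff `∫ min(fP, p i · f i) dm = p i` for every `i`. -/
theorem eigenpreparation_mixing_iff {Λ : Type*} [MeasurableSpace Λ] (m : Measure Λ)
    (n : ℕ) (f : Fin n → Λ → ℝ≥0∞)
    (hfm : ∀ i, Measurable (f i)) (hf1 : ∀ i, ∫⁻ x, f i x ∂m = 1)
    (hdisj : ∀ i j, i ≠ j → m ({x | 0 < f i x} ∩ {x | 0 < f j x}) = 0)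
    (p : Fin n → ℝ≥0∞) (hp : ∑ i, p i = 1)
    (fP : Λ → ℝ≥0∞) (hfPm : Measurable fP) (hfP1 : ∫⁻ x, fP x ∂m = 1) :
    (fP =ᵐ[m] fun x => ∑ i, p i * f i x)
      ↔ ∀ i, ∫⁻ x, min (fP x) (p i * f i x) ∂m = p i := by
  have hpf (i) : ∫⁻ x, p i * f i x ∂m = p i := by
    rw [lintegral_const_mul _ (hfm i), hf1, mul_one]
  constructor
  · intro h i
    rw [← hpf i]
    refine lintegral_congr_ae ?_
    filter_upwards [h] with x hx
    rw [hx, hpf i]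
    exact min_eq_right
      (Finset.single_le_sum (f := fun j => p j * f j x) (fun _ _ => zero_le) (Finset.mem_univ i))
  · intro h
    have hp_ne_top (i) : p i ≠ ∞ :=
      ne_top_of_le_ne_top (hp ▸ ENNReal.one_ne_top)
        (Finset.single_le_sum (fun _ _ => zero_le) (Finset.mem_univ i))
    have hle : ∀ᵐ x ∂m, ∀ i, p i * f i x ≤ fP x := by
      refine ae_all_iff.2 fun i => ?_
      have hmin : (fun x => min (fP x) (p i * f i x)) =ᵐ[m] fun x => p i * f i x :=
        ae_eq_of_ae_le_of_lintegral_le (ae_of_all _ fun x => min_le_right _ _)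
          (by rw [h i]; exact hp_ne_top i) ((hfm i).const_mul _).aemeasurable
          (by rw [h i, hpf i])
      filter_upwards [hmin] with x hx
      exact min_eq_right_iff.1 hx
    have hdisj' : ∀ᵐ x ∂m, ∀ i j, i ≠ j → f i x ≠ 0 → f j x = 0 := by
      refine ae_all_iff.2 fun i => ae_all_iff.2 fun j => ae_all_iff.2 fun hij => ?_
      filter_upwards [measure_eq_zero_iff_ae_notMem.1 (hdisj i j hij)] with x hx hi
      by_contra hj
      exact hx ⟨pos_iff_ne_zero.2 hi, pos_iff_ne_zero.2 hj⟩
    have hsum_le : (fun x => ∑ i, p i * f i x) ≤ᵐ[m] fP := by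
      filter_upwards [hle, hdisj'] with x hx hd
      by_cases h0 : ∃ i, f i x ≠ 0
      · obtain ⟨i, hi⟩ := h0
        rw [Finset.sum_eq_single i (fun j _ hji => by rw [hd i j hji.symm hi, mul_zero])
          (fun hi' => absurd (Finset.mem_univ i) hi')]
        exact hx i
      · push Not at h0
        simp [h0]
    have hsum : ∫⁻ x, ∑ i, p i * f i x ∂m = 1 := by
      rw [lintegral_finsetSum _ fun i _ => (hfm i).const_mul _]
      simp_rw [hpf, hp]
    exact (ae_eq_of_ae_le_of_lintegral_le hsum_le (by rw [hsum]; exact ENNReal.one_ne_top)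
      hfPm.aemeasurable (by rw [hsum, hfP1])).symm
end

section
/- The explicit quantum fragment: in ℂ³ with standard basis q1 = (1,0,0), q2 = (0,1,0), q3 = (0,0,1), let a1 = (1/√6)(2,1,−1), a2 = (1/√2)(0,1,1), a3 = (1/√3)(−1,1,−1), let U be the matrix with rows (√2/2, −√2/2, 0), (√2/2, √2/2, 0), (0,0,1), and let ψ = (1/4)(1+√3, 1−√3, 2√2). Then: (i) {a1, a2, a3} is an orthonormal basis and U is unitary with ‖ψ‖ = 1; (ii) ⟨a2, q1⟩ = 0, ⟨a3, U q1⟩ = 0 and ⟨q3, U q1⟩ = 0; and (iii) |⟨q1, ψ⟩|² − |⟨q2, Uψ⟩|² − |⟨a1, Uψ⟩|² = (10√3 − 7)/48. -/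
open Matrix
noncomputable section

namespace QuantumFragment

/-- The standard basis `q1, q2, q3` of `ℂ³` (eigenvectors of the macro-observable `Q`). -/
def q : Fin 3 → Fin 3 → ℂ := ![![1, 0, 0], ![0, 1, 0], ![0, 0, 1]]

/-- The basis `a1 = (1/√6)(2,1,−1)`, `a2 = (1/√2)(0,1,1)`, `a3 = (1/√3)(−1,1,−1)`
of the measurement `A`. -/
def a : Fin 3 → Fin 3 → ℂ :=
  ![![(2 / Real.sqrt 6 : ℝ), (1 / Real.sqrt 6 : ℝ), (-1 / Real.sqrt 6 : ℝ)],
    ![0, (1 / Real.sqrt 2 : ℝ), (1 / Real.sqrt 2 : ℝ)],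
    ![(-1 / Real.sqrt 3 : ℝ), (1 / Real.sqrt 3 : ℝ), (-1 / Real.sqrt 3 : ℝ)]]

/-- The transformation `U` : rotation by `π/4` in the `q1`-`q2` plane. -/
def U : Matrix (Fin 3) (Fin 3) ℂ :=
  ![![(Real.sqrt 2 / 2 : ℝ), (-(Real.sqrt 2) / 2 : ℝ), 0],
    ![(Real.sqrt 2 / 2 : ℝ), (Real.sqrt 2 / 2 : ℝ), 0],
    ![0, 0, 1]]

/-- The preparation state `ψ = (1/4)(1+√3, 1−√3, 2√2)`. -/
def ψ : Fin 3 → ℂ :=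
  ![((1 + Real.sqrt 3) / 4 : ℝ), ((1 - Real.sqrt 3) / 4 : ℝ), (2 * Real.sqrt 2 / 4 : ℝ)]

/-- `U` sends `ψ` to `(√6/4, √2/4, √2/2)`. -/
lemma U_mulVec_ψ :
    U.mulVec ψ = ![((√2 * √3 / 4 : ℝ) : ℂ), ((√2 / 4 : ℝ) : ℂ), ((√2 / 2 : ℝ) : ℂ)] := by
  ext i
  fin_cases i <;>
    · simp [U, ψ, Matrix.mulVec, dotProduct, Fin.sum_univ_three]
      ring

lemma a_orthonormal (i j : Fin 3) : star (a i) ⬝ᵥ a j = if i = j then 1 else 0 := by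
  have h2 : ((√2 : ℝ) : ℂ) ^ 2 = 2 := by norm_cast; simp
  have h3 : ((√3 : ℝ) : ℂ) ^ 2 = 3 := by norm_cast; simp
  have h6 : ((√6 : ℝ) : ℂ) ^ 2 = 6 := by norm_cast; simp
  fin_cases i <;> fin_cases j <;>
    simp [a, dotProduct, Complex.conj_ofNat, Fin.sum_univ_three] <;> ring_nf <;>
    norm_num [h2, h3, h6]

lemma U_mem_unitaryGroup : U ∈ Matrix.unitaryGroup (Fin 3) ℂ := by
  have h2 : ((√2 : ℝ) : ℂ) ^ 2 = 2 := by norm_cast; simp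
  rw [Matrix.mem_unitaryGroup_iff]
  ext i j
  fin_cases i <;> fin_cases j <;>
    simp only [Matrix.mul_apply, Matrix.star_apply, Fin.sum_univ_three] <;>
    simp [U] <;> ring_nf <;>
    norm_num [h2]

lemma ψ_normalized : star ψ ⬝ᵥ ψ = 1 := by
  have h2 : ((√2 : ℝ) : ℂ) ^ 2 = 2 := by norm_cast; simp
  have h3 : ((√3 : ℝ) : ℂ) ^ 2 = 3 := by norm_cast; simp
  simp [ψ, dotProduct, Complex.conj_ofNat, Fin.sum_univ_three]
  linear_combination h2 / 4 + h3 / 8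

lemma normSq_q_zero_ψ : Complex.normSq (star (q 0) ⬝ᵥ ψ) = (2 + √3) / 8 := by
  have h : star (q 0) ⬝ᵥ ψ = (((1 + √3) / 4 : ℝ) : ℂ) := by
    simp [q, ψ, dotProduct, Fin.sum_univ_three]
  rw [h, Complex.normSq_ofReal]
  linear_combination Real.sq_sqrt (show (0 : ℝ) ≤ 3 by norm_num) / 16

lemma normSq_q_one_U_ψ : Complex.normSq (star (q 1) ⬝ᵥ U.mulVec ψ) = 1 / 8 := by
  have h : star (q 1) ⬝ᵥ U.mulVec ψ = ((√2 / 4 : ℝ) : ℂ) := by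
    simp [U_mulVec_ψ, q, dotProduct, Fin.sum_univ_three]
  rw [h, Complex.normSq_ofReal]
  linear_combination Real.sq_sqrt (show (0 : ℝ) ≤ 2 by norm_num) / 16

lemma normSq_a_zero_U_ψ :
    Complex.normSq (star (a 0) ⬝ᵥ U.mulVec ψ) = 13 / 48 - √3 / 12 := by
  have h3 := Real.sq_sqrt (show (0 : ℝ) ≤ 3 by norm_num)
  have h6 : √6 = √2 * √3 := by rw [← Real.sqrt_mul (by norm_num)]; norm_num
  have h : star (a 0) ⬝ᵥ U.mulVec ψ = ((1 / 2 - √3 / 12 : ℝ) : ℂ) := by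
    have hr : 2 / √6 * (√2 * √3 / 4) + 1 / √6 * (√2 / 4) + -1 / √6 * (√2 / 2)
        = 1 / 2 - √3 / 12 := by
      rw [h6]
      field_simp
      linear_combination 8 * h3
    rw [← hr, U_mulVec_ψ]
    simp [a, dotProduct, Complex.conj_ofNat, Fin.sum_univ_three]
  rw [h, Complex.normSq_ofReal]
  linear_combination h3 / 144

/-- The explicit quantum fragment: (i) `{a1,a2,a3}` is an orthonormal basis, `U` is unitary
and `ψ` is normalized; (ii) `⟨a2,q1⟩ = 0`, `⟨a3,U q1⟩ = 0`, `⟨q3,U q1⟩ = 0`; and (iii) the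
Born-rule combination `|⟨q1,ψ⟩|² − |⟨q2,Uψ⟩|² − |⟨a1,Uψ⟩|²` equals `(10√3 − 7)/48 ≈ 0.215`. -/
theorem quantum_fragment :
    -- (i) orthonormality, unitarity, normalization
    ((∀ i j, star (a i) ⬝ᵥ a j = if i = j then 1 else 0)
      ∧ U ∈ Matrix.unitaryGroup (Fin 3) ℂ
      ∧ star ψ ⬝ᵥ ψ = 1)
    -- (ii) the vanishing amplitudes ⟨a2,q1⟩, ⟨a3,U q1⟩, ⟨q3,U q1⟩
    ∧ (star (a 1) ⬝ᵥ q 0 = 0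
      ∧ star (a 2) ⬝ᵥ U.mulVec (q 0) = 0
      ∧ star (q 2) ⬝ᵥ U.mulVec (q 0) = 0)
    -- (iii) the quantum violation value
    ∧ Complex.normSq (star (q 0) ⬝ᵥ ψ)
        - Complex.normSq (star (q 1) ⬝ᵥ U.mulVec ψ)
        - Complex.normSq (star (a 0) ⬝ᵥ U.mulVec ψ)
      = (10 * Real.sqrt 3 - 7) / 48 := by
  refine ⟨⟨a_orthonormal, U_mem_unitaryGroup, ψ_normalized⟩, ⟨?_, ?_, ?_⟩, ?_⟩
  · simp [a, q, dotProduct, Fin.sum_univ_three]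
  · simp [a, q, U, Matrix.mulVec, dotProduct, Fin.sum_univ_three]
    ring
  · simp [q, U, Matrix.mulVec, dotProduct, Fin.sum_univ_three]
  · rw [normSq_q_zero_ψ, normSq_q_one_U_ψ, normSq_a_zero_U_ψ]
    ring

end QuantumFragment
end
end
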